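/- Every W-orbit of 10-element cliques in C with weights in {1,2} contains a clique K that contains the two exceptional classes (1,1,1,0,0,0,0,0,0) and (1,0,0,1,1,0,0,0,0) and contains no other exceptional class of the form (1, b_1, ..., b_8) with exactly two of the coordinates b_1, ..., b_8 equal to 1 and the remaining six equal to 0 (i.e., K contains the classes of the lines l_{1,2} and l_{3,4} and of no other line l_{i,j}). -/

import Mathlib

/-- The intersection pairing on `ℤ⁹`, the Picard lattice of a del Pezzo surface of degree 1. -/
def B (v w : Fin 9 → ℤ) : ℤ := v 0 * w 0 - ∑ i : Fin 8, v i.succ * w i.succ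

/-- The canonical class `K = (-3, -1, …, -1)`. -/
def Kcl : Fin 9 → ℤ := fun i => if i = 0 then -3 else -1

/-- A vector is an exceptional class if `B(v,v) = -1` and `B(v,K) = -1`. -/
def IsExc (v : Fin 9 → ℤ) : Prop := B v v = -1 ∧ B v Kcl = -1

/-- The type of exceptional classes (the set `C`). -/
abbrev Exc : Type := {v : Fin 9 → ℤ // IsExc v}

/-- The pairing on exceptional classes. -/
def Bx (x y : Exc) : ℤ := B x.1 y.1

/-- `S` is a clique with weights in `M` if `B(x,y) ∈ M` for all distinct `x, y ∈ S`. -/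
def IsClique (M : Set ℤ) (S : Finset Exc) : Prop :=
  ∀ x ∈ S, ∀ y ∈ S, x ≠ y → Bx x y ∈ M

/-- A bijection of `C` preserving the pairing `B`: an element of the Weyl group `W`. -/
def PreservesB (g : Exc ≃ Exc) : Prop := ∀ x y : Exc, Bx (g x) (g y) = Bx x y

/-- Two finite subsets of `C` lie in the same orbit of `W`. -/
def SameOrbit (S T : Finset Exc) : Prop :=
  ∃ g : Exc ≃ Exc, PreservesB g ∧ S.image g = T

/-- The class of the line `ℓ_{1,2}` through `P₁` and `P₂`. -/
def l12 : Fin 9 → ℤ := ![1, 1, 1, 0, 0, 0, 0, 0, 0]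
/-- The class of the line `ℓ_{3,4}`. -/
def l34 : Fin 9 → ℤ := ![1, 0, 0, 1, 1, 0, 0, 0, 0]

/-- A vector of the form `(1, b₁, …, b₈)` with exactly two of the `bᵢ` equal to 1 and the
remaining six equal to 0: the class of a line `ℓ_{i,j}`. -/
def IsLineClass (v : Fin 9 → ℤ) : Prop :=
  v 0 = 1 ∧ (∀ i : Fin 8, v i.succ = 0 ∨ v i.succ = 1) ∧ (∑ i : Fin 8, v i.succ) = 2


theorem B_comm (v w : Fin 9 → ℤ) : B v w = B w v := by
  simp only [B, mul_comm]

theorem B_add (u v w : Fin 9 → ℤ) : B (u + v) w = B u w + B v w := by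
  simp only [B, Pi.add_apply, add_mul, Finset.sum_add_distrib]; ring

theorem B_smul (c : ℤ) (v w : Fin 9 → ℤ) : B (c • v) w = c * B v w := by
  simp only [B, Pi.smul_apply, smul_eq_mul, mul_assoc, ← Finset.mul_sum]; ring

theorem B_add' (u v w : Fin 9 → ℤ) : B w (u + v) = B w u + B w v := by
  rw [B_comm, B_add, B_comm u, B_comm v]

theorem B_smul' (c : ℤ) (v w : Fin 9 → ℤ) : B w (c • v) = c * B w v := by
  rw [B_comm, B_smul, B_comm v]

/-- Reflection in a root. -/
def rv (α v : Fin 9 → ℤ) : Fin 9 → ℤ := v + B v α • α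

def IsRt (α : Fin 9 → ℤ) : Prop := B α α = -2 ∧ B α Kcl = 0

instance (α : Fin 9 → ℤ) : Decidable (IsRt α) := by unfold IsRt; infer_instance

theorem rv_B {α : Fin 9 → ℤ} (h : IsRt α) (v w : Fin 9 → ℤ) : B (rv α v) (rv α w) = B v w := by
  simp only [rv, B_add, B_add', B_smul, B_smul', h.1, B_comm α]; ring

theorem rv_K {α : Fin 9 → ℤ} (h : IsRt α) (v : Fin 9 → ℤ) : B (rv α v) Kcl = B v Kcl := by
  simp only [rv, B_add, B_smul, h.2]; ring

theorem rv_rv {α : Fin 9 → ℤ} (h : IsRt α) (v : Fin 9 → ℤ) : rv α (rv α v) = v := by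
  simp only [rv, B_add, B_smul, h.1]
  ext i
  simp only [Pi.add_apply, Pi.smul_apply, smul_eq_mul]; ring

def rx (α : Fin 9 → ℤ) (h : IsRt α) : Exc ≃ Exc where
  toFun x := ⟨rv α x.1, by
    have := x.2
    exact ⟨by rw [rv_B h]; exact this.1, by rw [rv_K h]; exact this.2⟩⟩
  invFun x := ⟨rv α x.1, by
    have := x.2
    exact ⟨by rw [rv_B h]; exact this.1, by rw [rv_K h]; exact this.2⟩⟩
  left_inv x := Subtype.ext (rv_rv h _)
  right_inv x := Subtype.ext (rv_rv h _)

theorem rx_pb (α : Fin 9 → ℤ) (h : IsRt α) : PreservesB (rx α h) := fun _ _ => rv_B h _ _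

theorem pb_trans {g k : Exc ≃ Exc} (hg : PreservesB g) (hk : PreservesB k) :
    PreservesB (g.trans k) := fun x y => (hk _ _).trans (hg _ _)

theorem pb_symm {g : Exc ≃ Exc} (hg : PreservesB g) : PreservesB g.symm := fun _ _ => by
  rw [← hg]; simp

theorem rv_fix {α z : Fin 9 → ℤ} (h : B z α = 0) : rv α z = z := by simp [rv, h]

/-- a height function -/
def ht (v : Fin 9 → ℤ) : ℤ :=
  10 * v 0 + v 1 + 2 * v 2 + 3 * v 3 + 4 * v 4 + 5 * v 5 + 6 * v 6 + 7 * v 7 + 8 * v 8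

theorem ht_rv (α v : Fin 9 → ℤ) : ht (rv α v) = ht v + B v α * ht α := by
  simp only [ht, rv, Pi.add_apply, Pi.smul_apply, smul_eq_mul]; ring

theorem B_expand (v w : Fin 9 → ℤ) : B v w = v 0 * w 0 - (v 1 * w 1 + v 2 * w 2 + v 3 * w 3 +
    v 4 * w 4 + v 5 * w 5 + v 6 * w 6 + v 7 * w 7 + v 8 * w 8) := by
  simp only [B, Fin.sum_univ_eight]; rfl

theorem exc_eqs {v : Fin 9 → ℤ} (h : IsExc v) :
    v 1 + v 2 + v 3 + v 4 + v 5 + v 6 + v 7 + v 8 = 3 * v 0 - 1 ∧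
    v 1 * v 1 + v 2 * v 2 + v 3 * v 3 + v 4 * v 4 + v 5 * v 5 + v 6 * v 6 + v 7 * v 7 + v 8 * v 8
      = v 0 * v 0 + 1 := by
  obtain ⟨h1, h2⟩ := h
  rw [B_expand] at h1 h2
  simp [Kcl] at h2
  constructor <;> linarith

theorem cs8 (a b c d e f g h : ℤ) : (a + b + c + d + e + f + g + h) ^ 2 ≤
    8 * (a * a + b * b + c * c + d * d + e * e + f * f + g * g + h * h) := by
  have := sq_sum_le_card_mul_sum_sq (s := Finset.univ) (f := ![a, b, c, d, e, f, g, h])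
  simp [Fin.sum_univ_eight] at this
  linarith [this]

theorem sq_self_add (b : ℤ) : 0 ≤ b * b + b := by
  rcases le_or_gt 0 b with h | h
  · positivity
  · nlinarith

theorem sq_self_sub (b : ℤ) : 0 ≤ b * b - b := by
  have := sq_self_add (-b)
  linarith

theorem exc_a {v : Fin 9 → ℤ} (h : IsExc v) : 0 ≤ v 0 ∧ v 0 ≤ 7 := by
  obtain ⟨h1, h2⟩ := exc_eqs h
  have := cs8 (v 1) (v 2) (v 3) (v 4) (v 5) (v 6) (v 7) (v 8)
  rw [h1, h2] at this
  have hu : v 0 ≤ 7 := by nlinarith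
  have hl : -1 ≤ v 0 := by nlinarith
  refine ⟨?_, hu⟩
  by_contra hc
  have h0 : v 0 = -1 := by omega
  rw [h0] at h1 h2
  linarith [sq_self_add (v 1), sq_self_add (v 2), sq_self_add (v 3), sq_self_add (v 4),
    sq_self_add (v 5), sq_self_add (v 6), sq_self_add (v 7), sq_self_add (v 8)]

theorem exc_ht {v : Fin 9 → ℤ} (h : IsExc v) : 0 ≤ ht v + 300 := by
  obtain ⟨h1, h2⟩ := exc_eqs h
  obtain ⟨h3, h4⟩ := exc_a h
  have h5 : v 0 * v 0 ≤ 49 := by nlinarith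
  have key : ∀ b : ℤ, b * b ≤ 50 → -8 ≤ b := fun b hb => by nlinarith
  have s := fun i => mul_self_nonneg (v i)
  have k1 := key (v 1) (by linarith [s 1, s 2, s 3, s 4, s 5, s 6, s 7, s 8])
  have k2 := key (v 2) (by linarith [s 1, s 2, s 3, s 4, s 5, s 6, s 7, s 8])
  have k3 := key (v 3) (by linarith [s 1, s 2, s 3, s 4, s 5, s 6, s 7, s 8])
  have k4 := key (v 4) (by linarith [s 1, s 2, s 3, s 4, s 5, s 6, s 7, s 8])
  have k5 := key (v 5) (by linarith [s 1, s 2, s 3, s 4, s 5, s 6, s 7, s 8])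
  have k6 := key (v 6) (by linarith [s 1, s 2, s 3, s 4, s 5, s 6, s 7, s 8])
  have k7 := key (v 7) (by linarith [s 1, s 2, s 3, s 4, s 5, s 6, s 7, s 8])
  have k8 := key (v 8) (by linarith [s 1, s 2, s 3, s 4, s 5, s 6, s 7, s 8])
  unfold ht
  linarith

theorem descent (R : List (Fin 9 → ℤ)) (hR : ∀ α ∈ R, IsRt α ∧ 0 < ht α) (e v0 : Fin 9 → ℤ) (c : ℤ)
    (he : ∀ α ∈ R, B e α = 0)
    (hdom : ∀ z, IsExc z → B e z = c → (∀ α ∈ R, 0 ≤ B z α) → z = v0) (n : ℕ) :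
    ∀ x : Exc, B e x.1 = c → ht x.1 + 300 < n → ∃ g : Exc ≃ Exc, PreservesB g ∧
      (∀ z : Exc, z.1 = e → g z = z) ∧ (g x).1 = v0 := by
  induction n with
  | zero => intro x _ h; have := exc_ht x.2; push_cast at h; omega
  | succ n ih =>
    intro x hx hn
    by_cases hd : ∀ α ∈ R, 0 ≤ B x.1 α
    · exact ⟨Equiv.refl _, fun _ _ => rfl, fun _ _ => rfl, hdom _ x.2 hx hd⟩
    · push Not at hd
      obtain ⟨α, hα, hneg⟩ := hd
      obtain ⟨hr, hp⟩ := hR α hα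
      have hfix : rv α e = e := rv_fix (he α hα)
      obtain ⟨g, hg, hge, hgx⟩ := ih (rx α hr x)
        (by change B e (rv α x.1) = c; rw [← hx, ← rv_B hr e x.1, hfix])
        (by change ht (rv α x.1) + 300 < n
            rw [ht_rv]; push_cast at hn; nlinarith)
      refine ⟨(rx α hr).trans g, pb_trans (rx_pb α hr) hg, ?_, hgx⟩
      intro z hz
      have : rx α hr z = z := Subtype.ext (by change rv α z.1 = z.1; rw [hz, hfix])
      rw [Equiv.trans_apply, this, hge z hz]

/-- Simple roots orthogonal to `e8`. -/
def R7 : List (Fin 9 → ℤ) := [![1,1,1,1,0,0,0,0,0], ![0,-1,1,0,0,0,0,0,0], ![0,0,-1,1,0,0,0,0,0],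
  ![0,0,0,-1,1,0,0,0,0], ![0,0,0,0,-1,1,0,0,0], ![0,0,0,0,0,-1,1,0,0], ![0,0,0,0,0,0,-1,1,0]]

def R8 : List (Fin 9 → ℤ) := ![0,0,0,0,0,0,0,-1,1] :: R7

def e8 : Fin 9 → ℤ := ![0,0,0,0,0,0,0,0,-1]
def l18 : Fin 9 → ℤ := ![1,1,0,0,0,0,0,0,1]

theorem R7_dom {z : Fin 9 → ℤ} (h : ∀ α ∈ R7, 0 ≤ B z α) : z 1 + z 2 + z 3 ≤ z 0 ∧ z 2 ≤ z 1 ∧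
    z 3 ≤ z 2 ∧ z 4 ≤ z 3 ∧ z 5 ≤ z 4 ∧ z 6 ≤ z 5 ∧ z 7 ≤ z 6 := by
  simp [R7, B_expand] at h
  omega

theorem sq_add_zero {b : ℤ} (h : b * b + b = 0) : b = 0 ∨ b = -1 := by
  have : b * (b + 1) = 0 := by linarith
  rcases mul_eq_zero.1 this with h | h
  · exact Or.inl h
  · right; omega

theorem sq_sub_zero {b : ℤ} (h : b * b - b = 0) : b = 0 ∨ b = 1 := by
  have : b * (b - 1) = 0 := by linarith
  rcases mul_eq_zero.1 this with h | h
  · exact Or.inl h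
  · right; omega

theorem dom8 (z : Fin 9 → ℤ) (hz : IsExc z) (h : ∀ α ∈ R8, 0 ≤ B z α) : z = e8 := by
  obtain ⟨d0, d1, d2, d3, d4, d5, d6⟩ := R7_dom (fun α hα => h α (List.mem_cons_of_mem _ hα))
  have d7 : z 8 ≤ z 7 := by
    have := h _ List.mem_cons_self
    simp [B_expand] at this
    omega
  obtain ⟨h1, h2⟩ := exc_eqs hz
  obtain ⟨h3, -⟩ := exc_a hz
  have h4 : z 0 ≤ 3 := by omega
  have s1 := sq_self_add (z 1)
  have s2 := sq_self_add (z 2)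
  have s3 := sq_self_add (z 3)
  have s4 := sq_self_add (z 4)
  have s5 := sq_self_add (z 5)
  have s6 := sq_self_add (z 6)
  have s7 := sq_self_add (z 7)
  have s8 := sq_self_add (z 8)
  have h0 : z 0 = 0 ∨ z 0 = 3 := by omega
  rcases h0 with h0 | h0
  · rw [h0] at h1 h2
    have t1 := sq_add_zero (b := z 1) (by linarith)
    have t2 := sq_add_zero (b := z 2) (by linarith)
    have t3 := sq_add_zero (b := z 3) (by linarith)
    have t4 := sq_add_zero (b := z 4) (by linarith)
    have t5 := sq_add_zero (b := z 5) (by linarith)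
    have t6 := sq_add_zero (b := z 6) (by linarith)
    have t7 := sq_add_zero (b := z 7) (by linarith)
    have t8 := sq_add_zero (b := z 8) (by linarith)
    clear s1 s2 s3 s4 s5 s6 s7 s8 h2
    ext i
    fin_cases i <;> simp [e8] <;> omega
  · exfalso
    have t1 : z 1 = 1 := by omega
    have t2 : z 2 = 1 := by omega
    have t3 : z 3 = 1 := by omega
    have t4 : z 4 = 1 := by omega
    have t5 : z 5 = 1 := by omega
    have t6 : z 6 = 1 := by omega
    have t7 : z 7 = 1 := by omega
    have t8 : z 8 = 1 := by omega
    rw [t1, t2, t3, t4, t5, t6, t7, t8, h0] at h2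
    norm_num at h2

theorem dom7 (z : Fin 9 → ℤ) (hz : IsExc z) (hb : B e8 z = 1) (h : ∀ α ∈ R7, 0 ≤ B z α) :
    z = l18 := by
  obtain ⟨d0, d1, d2, d3, d4, d5, d6⟩ := R7_dom h
  have d8 : z 8 = 1 := by
    simp [e8, B_expand] at hb
    omega
  obtain ⟨h1, h2⟩ := exc_eqs hz
  obtain ⟨h3, -⟩ := exc_a hz
  have s1 := sq_self_sub (z 1)
  have s2 := sq_self_sub (z 2)
  have s3 := sq_self_sub (z 3)
  have s4 := sq_self_sub (z 4)
  have s5 := sq_self_sub (z 5)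
  have s6 := sq_self_sub (z 6)
  have s7 := sq_self_sub (z 7)
  rw [d8] at h1 h2
  have h0 : z 0 = 0 ∨ z 0 = 1 ∨ z 0 = 3 := by omega
  rcases h0 with h0 | h0 | h0
  · rw [h0] at h1 h2
    exfalso
    linarith [sq_self_add (z 1), sq_self_add (z 2), sq_self_add (z 3), sq_self_add (z 4),
      sq_self_add (z 5), sq_self_add (z 6), sq_self_add (z 7)]
  · rw [h0] at h1 h2
    have t1 := sq_sub_zero (b := z 1) (by linarith)
    have t2 := sq_sub_zero (b := z 2) (by linarith)
    have t3 := sq_sub_zero (b := z 3) (by linarith)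
    have t4 := sq_sub_zero (b := z 4) (by linarith)
    have t5 := sq_sub_zero (b := z 5) (by linarith)
    have t6 := sq_sub_zero (b := z 6) (by linarith)
    have t7 := sq_sub_zero (b := z 7) (by linarith)
    clear s1 s2 s3 s4 s5 s6 s7 h2
    ext i
    fin_cases i <;> simp [l18] <;> omega
  · exfalso
    have t1 : z 1 = 1 := by omega
    have t2 : z 2 = 1 := by omega
    have t3 : z 3 = 1 := by omega
    have t4 : z 4 = 1 := by omega
    have t5 : z 5 = 1 := by omega
    have t6 : z 6 = 1 := by omega
    have t7 : z 7 = 1 := by omega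
    rw [t1, t2, t3, t4, t5, t6, t7, h0] at h2
    norm_num at h2

theorem trans_pair (x y : Exc) (h : Bx x y = 1) :
    ∃ g : Exc ≃ Exc, PreservesB g ∧ (g x).1 = e8 ∧ (g y).1 = l18 := by
  obtain ⟨g, hg, -, hgx⟩ := descent R8 (by simp only [IsRt, B_expand]; decide +kernel) 0 e8 0 (by simp only [B_expand]; decide +kernel)
    (fun z hz _ => dom8 z hz) (ht x.1 + 301).toNat x (by simp [B])
    (by have := exc_ht x.2; omega)
  have hy : B e8 (g y).1 = 1 := by rw [← h, ← hg x y, ← hgx]; rfl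
  obtain ⟨k, hk, hke, hky⟩ := descent R7 (by simp only [IsRt, B_expand]; decide +kernel) e8 l18 1 (by simp only [B_expand]; decide +kernel)
    dom7 (ht (g y).1 + 301).toNat (g y) hy (by have := exc_ht (g y).2; omega)
  exact ⟨g.trans k, pb_trans hg hk, by rw [Equiv.trans_apply, hke _ hgx, hgx], hky⟩

def x12 : Exc := ⟨l12, by simp only [IsExc, B_expand]; decide +kernel⟩
def x34 : Exc := ⟨l34, by simp only [IsExc, B_expand]; decide +kernel⟩

theorem trans_pair' (x y : Exc) (h : Bx x y = 1) :
    ∃ g : Exc ≃ Exc, PreservesB g ∧ g x = x12 ∧ g y = x34 := by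
  obtain ⟨g, hg, h1, h2⟩ := trans_pair x y h
  obtain ⟨k, hk, h3, h4⟩ := trans_pair x12 x34 (by simp only [Bx, B_expand]; decide +kernel)
  refine ⟨g.trans k.symm, pb_trans hg (pb_symm hk), ?_, ?_⟩
  · rw [Equiv.trans_apply, Equiv.symm_apply_eq]; exact Subtype.ext (h1.trans h3.symm)
  · rw [Equiv.trans_apply, Equiv.symm_apply_eq]; exact Subtype.ext (h2.trans h4.symm)

/-- Words of reflections fixing `l12` and `l34`. -/
def wd : Fin 17 → List (Fin 9 → ℤ) := ![
  [![1, 0, 1, 0, 1, 0, 0, 0, 1], ![1, 0, 1, 1, 0, 1, 0, 0, 0]],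
  [![1, 0, 1, 0, 1, 0, 0, 0, 1], ![1, 0, 1, 1, 0, 0, 1, 0, 0], ![1, 1, 0, 0, 1, 0, 0, 1, 0]],
  [![1, 0, 1, 0, 1, 0, 0, 1, 0], ![1, 0, 1, 1, 0, 0, 1, 0, 0], ![1, 1, 0, 1, 0, 1, 0, 0, 0]],
  [![2, 1, 1, 1, 1, 1, 0, 1, 0]],
  [![1, 0, 1, 1, 0, 0, 0, 0, 1], ![1, 1, 0, 1, 0, 1, 0, 0, 0], ![2, 1, 1, 1, 1, 0, 1, 1, 0]],
  [![1, 1, 0, 0, 1, 0, 0, 1, 0], ![1, 1, 0, 1, 0, 0, 1, 0, 0], ![2, 1, 1, 1, 1, 1, 0, 0, 1]],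
  [![1, 0, 1, 0, 1, 0, 0, 0, 1], ![1, 0, 1, 1, 0, 0, 0, 1, 0], ![1, 1, 0, 0, 1, 1, 0, 0, 0]],
  [![1, 0, 1, 1, 0, 0, 0, 1, 0], ![1, 1, 0, 0, 1, 0, 1, 0, 0]],
  [![1, 0, 1, 0, 1, 1, 0, 0, 0], ![2, 1, 1, 1, 1, 0, 1, 1, 0]],
  [![1, 0, 1, 1, 0, 0, 0, 1, 0], ![2, 1, 1, 1, 1, 0, 1, 0, 1]],
  [![1, 0, 1, 1, 0, 0, 0, 0, 1], ![2, 1, 1, 1, 1, 0, 1, 0, 1], ![2, 1, 1, 1, 1, 1, 0, 1, 0]],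
  [![1, 0, 1, 1, 0, 1, 0, 0, 0], ![1, 1, 0, 0, 1, 0, 0, 0, 1]],
  [![1, 0, 1, 0, 1, 1, 0, 0, 0], ![2, 1, 1, 1, 1, 0, 1, 0, 1]],
  [![1, 0, 1, 0, 1, 0, 0, 0, 1], ![1, 1, 0, 1, 0, 0, 0, 1, 0]],
  [![1, 0, 1, 1, 0, 0, 1, 0, 0]],
  [![1, 0, 1, 0, 1, 0, 0, 1, 0], ![1, 1, 0, 1, 0, 0, 0, 0, 1]],
  [![1, 0, 1, 0, 1, 0, 0, 0, 1], ![1, 1, 0, 0, 1, 1, 0, 0, 0], ![1, 1, 0, 1, 0, 0, 1, 0, 0]]]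

def app (l : List (Fin 9 → ℤ)) (v : Fin 9 → ℤ) : Fin 9 → ℤ := l.foldr rv v
def appInv (l : List (Fin 9 → ℤ)) (v : Fin 9 → ℤ) : Fin 9 → ℤ := l.foldl (fun v α => rv α v) v

theorem appInv_app (l : List (Fin 9 → ℤ)) (hl : ∀ α ∈ l, IsRt α) (v : Fin 9 → ℤ) :
    appInv l (app l v) = v := by
  induction l with
  | nil => rfl
  | cons α l ih =>
    have : appInv (α :: l) (app (α :: l) v) = appInv l (rv α (rv α (app l v))) := rfl
    rw [this, rv_rv (hl α List.mem_cons_self), ih (fun β hβ => hl β (List.mem_cons_of_mem _ hβ))]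

theorem app_equiv (l : List (Fin 9 → ℤ))
    (hl : ∀ α ∈ l, IsRt α ∧ B l12 α = 0 ∧ B l34 α = 0) :
    ∃ g : Exc ≃ Exc, PreservesB g ∧ g x12 = x12 ∧ g x34 = x34 ∧ ∀ x, (g x).1 = app l x.1 := by
  induction l with
  | nil => exact ⟨Equiv.refl _, fun _ _ => rfl, rfl, rfl, fun _ => rfl⟩
  | cons α l ih =>
    obtain ⟨g, hg, h1, h2, h3⟩ := ih (fun β hβ => hl β (List.mem_cons_of_mem _ hβ))
    obtain ⟨hr, ha, hb⟩ := hl α List.mem_cons_self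
    refine ⟨g.trans (rx α hr), pb_trans hg (rx_pb α hr), ?_, ?_, ?_⟩
    · rw [Equiv.trans_apply, h1]; exact Subtype.ext (rv_fix ha)
    · rw [Equiv.trans_apply, h2]; exact Subtype.ext (rv_fix hb)
    · intro x; change rv α (g x).1 = rv α (app l x.1); rw [h3]

/-- The six lines `l_{i,j}` with `5 ≤ i < j ≤ 8`. -/
def octl : List (Fin 9 → ℤ) := [![1,0,0,0,0,1,1,0,0], ![1,0,0,0,0,1,0,1,0], ![1,0,0,0,0,1,0,0,1],
  ![1,0,0,0,0,0,1,1,0], ![1,0,0,0,0,0,1,0,1], ![1,0,0,0,0,0,0,1,1]]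

theorem mem_octl {v : Fin 9 → ℤ} (h : IsLineClass v) (h1 : 1 ≤ B v l12) (h2 : 1 ≤ B v l34) :
    v ∈ octl := by
  obtain ⟨ha, hb, hs⟩ := h
  rw [Fin.sum_univ_eight] at hs
  change v 1 + v 2 + v 3 + v 4 + v 5 + v 6 + v 7 + v 8 = 2 at hs
  have b1 : v 1 = 0 ∨ v 1 = 1 := hb 0
  have b2 : v 2 = 0 ∨ v 2 = 1 := hb 1
  have b3 : v 3 = 0 ∨ v 3 = 1 := hb 2
  have b4 : v 4 = 0 ∨ v 4 = 1 := hb 3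
  have b5 : v 5 = 0 ∨ v 5 = 1 := hb 4
  have b6 : v 6 = 0 ∨ v 6 = 1 := hb 5
  have b7 : v 7 = 0 ∨ v 7 = 1 := hb 6
  have b8 : v 8 = 0 ∨ v 8 = 1 := hb 7
  have e1 : v 1 + v 2 ≤ 0 := by simp [l12, B_expand] at h1; omega
  have e2 : v 3 + v 4 ≤ 0 := by simp [l34, B_expand] at h2; omega
  have c1 : v 1 = 0 := by omega
  have c2 : v 2 = 0 := by omega
  have c3 : v 3 = 0 := by omega
  have c4 : v 4 = 0 := by omega
  have hv : v = ![v 0, v 1, v 2, v 3, v 4, v 5, v 6, v 7, v 8] := by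
    ext i; fin_cases i <;> rfl
  rw [hv, ha, c1, c2, c3, c4]
  rw [c1, c2, c3, c4] at hs
  clear hv
  rcases b5 with b5 | b5 <;> rcases b6 with b6 | b6 <;> rcases b7 with b7 | b7 <;>
    rcases b8 with b8 | b8 <;> rw [b5, b6, b7, b8] at hs ⊢ <;> first | (exfalso; omega) | simp [octl]

theorem wd_ok : ∀ i, ∀ α ∈ wd i, IsRt α ∧ B l12 α = 0 ∧ B l34 α = 0 := by
  simp only [IsRt, B_expand]
  decide +kernel

def enc (v : Fin 9 → ℤ) : ℤ := 100000000 * v 0 + 10000000 * v 1 + 1000000 * v 2 + 100000 * v 3 +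
  10000 * v 4 + 1000 * v 5 + 100 * v 6 + 10 * v 7 + v 8

def encB (w : Fin 9 → ℤ) : List (Fin 9 → ℤ) → ℤ
  | [] => enc w
  | α :: l => encB w l + (w 0 * α 0 - (w 1 * α 1 + w 2 * α 2 + w 3 * α 3 +
    w 4 * α 4 + w 5 * α 5 + w 6 * α 6 + w 7 * α 7 + w 8 * α 8)) * encB α l

theorem rv_lin (α v β : Fin 9 → ℤ) (c : ℤ) : rv α (v + c • β) = rv α v + c • rv α β := by
  ext i
  simp only [rv, B_add, B_smul, Pi.add_apply, Pi.smul_apply, smul_eq_mul]; ring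

theorem appInv_lin (l : List (Fin 9 → ℤ)) : ∀ (v β : Fin 9 → ℤ) (c : ℤ),
    appInv l (v + c • β) = appInv l v + c • appInv l β := by
  induction l with
  | nil => intros; rfl
  | cons α l ih =>
    intro v β c
    change appInv l (rv α _) = appInv l (rv α _) + c • appInv l (rv α _)
    rw [rv_lin, ih]

theorem encB_eq (l : List (Fin 9 → ℤ)) : ∀ w, encB w l = enc (appInv l w) := by
  induction l with
  | nil => intro w; rfl
  | cons α l ih =>
    intro w
    change _ = enc (appInv l (w + B w α • α))
    rw [appInv_lin, encB, ih, ih, ← B_expand]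
    simp only [enc, Pi.add_apply, Pi.smul_apply, smul_eq_mul]; ring

/-- Decimal encodings of the preimages of the six lines under the words `wd i`. -/
def tab : Fin 17 → List ℤ := ![
  [201011101, 201011011, 100001001, 302111111, 201101101, 201101011],
  [311021111, 412121121, 421121121, 201010111, 210010111, 311110121],
  [311112110, 201101110, 412212111, 210101110, 421212111, 311201111],
  [311112110, 100001010, 311112011, 311111120, 522222121, 311111021],
  [412211211, 412211121, 522221221, 311201111, 421211211, 421211121],
  [421122111, 421212111, 320111111, 522222112, 421121112, 421211112],
  [412122111, 201011011, 311112011, 311021111, 421122111, 210011011],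
  [311111210, 210011110, 421121211, 100000110, 311110211, 210010111],
  [311111210, 311111120, 522221221, 201011110, 412121211, 412121121],
  [412211211, 522221212, 412211112, 311110211, 201100111, 311110112],
  [412212111, 412211112, 522222112, 412211121, 522222121, 522221122],
  [210011101, 210011011, 100001001, 421121112, 311111102, 311111012],
  [311111201, 522221212, 311111102, 412121211, 201011101, 412121112],
  [421211121, 311111021, 210101011, 311110121, 210100111, 100000011],
  [100001100, 201101110, 201101101, 100000110, 100000101, 201100111],
  [421211112, 210101011, 311111012, 210100111, 311110112, 100000011],
  [311111201, 421211211, 210101101, 421121211, 210011101, 320111111]]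

theorem tab_ok : ∀ i, ∀ w ∈ octl, encB w (wd i) ∈ tab i := by
  decide +kernel

theorem tab_cnt : ∀ i, ∀ n ∈ tab i, (Finset.univ.filter fun j => n ∈ tab j).card ≤ 2 := by
  decide +kernel

theorem mem_tab {i : Fin 17} {v : Fin 9 → ℤ} (h : app (wd i) v ∈ octl) : enc v ∈ tab i := by
  have := tab_ok i _ h
  rwa [encB_eq, appInv_app _ (fun α hα => (wd_ok i α hα).1)] at this

theorem hodge (w : Fin 9 → ℤ) (h : B w Kcl = 0) : B w w ≤ 0 := by
  rw [B_expand] at h ⊢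
  simp [Kcl] at h
  have := cs8 (w 1) (w 2) (w 3) (w 4) (w 5) (w 6) (w 7) (w 8)
  have h' : w 1 + w 2 + w 3 + w 4 + w 5 + w 6 + w 7 + w 8 = 3 * w 0 := by linarith
  rw [h'] at this
  nlinarith [sq_nonneg (w 0)]

theorem exists_orth (S : Finset Exc) (hcard : S.card = 10) (hcl : IsClique {1, 2} S) :
    ∃ x ∈ S, ∃ y ∈ S, x ≠ y ∧ Bx x y = 1 := by
  classical
  by_contra hcon
  have h2 : ∀ x ∈ S, ∀ y ∈ S, x ≠ y → B x.1 y.1 = 2 := by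
    intro x hx y hy hxy
    rcases hcl x hx y hy hxy with h | h
    · exact absurd ⟨x, hx, y, hy, hxy, h⟩ hcon
    · exact h
  obtain ⟨x, hx, y, hy, z, hz, hxy, hxz, hyz⟩ := Finset.two_lt_card.1 (by omega : 2 < S.card)
  obtain ⟨w, hw, hn⟩ := Finset.exists_mem_notMem_of_card_lt_card
    (lt_of_le_of_lt Finset.card_le_three (by omega : 3 < S.card) : ({x, y, z} : Finset Exc).card < _)
  simp only [Finset.mem_insert, Finset.mem_singleton, not_or] at hn
  obtain ⟨n1, n2, n3⟩ := hn
  have hKK : B Kcl Kcl = 1 := by rw [B_expand]; decide +kernel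
  have a1 := h2 x hx y hy hxy
  have a2 := h2 x hx z hz hxz
  have a3 := h2 y hy z hz hyz
  have a4 := h2 w hw x hx n1
  have a5 := h2 w hw y hy n2
  have a6 := h2 w hw z hz n3
  have k := hodge (x.1 + (y.1 + (z.1 + (w.1 + (4 : ℤ) • Kcl)))) (by
    simp only [B_add, B_smul, hKK, x.2.2, y.2.2, z.2.2, w.2.2]; norm_num)
  simp only [B_add, B_add', B_smul, B_smul', hKK, x.2.2, y.2.2, z.2.2, w.2.2, x.2.1, y.2.1, z.2.1,
    w.2.1, B_comm Kcl, a1, a2, a3, a4, a5, a6, B_comm y.1 x.1, B_comm z.1 x.1, B_comm z.1 y.1,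
    B_comm x.1 w.1, B_comm y.1 w.1, B_comm z.1 w.1] at k
  norm_num at k

/-- Every `W`-orbit of 10-element cliques in `C` with weights in `{1,2}` contains a clique
containing the classes of the lines `ℓ_{1,2}` and `ℓ_{3,4}` and of no other line `ℓ_{i,j}`. -/
theorem stmt11 (S : Finset Exc) (hcard : S.card = 10) (hcl : IsClique {1, 2} S) :
    ∃ T : Finset Exc, T.card = 10 ∧ IsClique {1, 2} T ∧ SameOrbit S T ∧
      (∃ x ∈ T, x.1 = l12) ∧ (∃ x ∈ T, x.1 = l34) ∧
      (∀ x ∈ T, IsLineClass x.1 → x.1 = l12 ∨ x.1 = l34) := by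

  classical
  obtain ⟨x, hx, y, hy, hxy, hB⟩ := exists_orth S hcard hcl
  obtain ⟨g, hg, hgx, hgy⟩ := trans_pair' x y hB
  choose k hk hk1 hk2 hk3 using fun i => app_equiv (wd i) (wd_ok i)
  have main : ∃ i, ∀ s ∈ S, IsLineClass (k i (g s)).1 → s = x ∨ s = y := by
    by_contra hcon
    push Not at hcon
    choose s hs hl hsx hsy using hcon
    have hoct : ∀ i, app (wd i) (g (s i)).1 ∈ octl := by
      intro i
      rw [← hk3]
      have p1 : Bx (k i (g (s i))) x12 = Bx (s i) x := by
        rw [← hk1 i, hk i, ← hgx, hg]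
      have p2 : Bx (k i (g (s i))) x34 = Bx (s i) y := by
        rw [← hk2 i, hk i, ← hgy, hg]
      apply mem_octl (hl i)
      · change 1 ≤ Bx (k i (g (s i))) x12
        rw [p1]
        rcases hcl _ (hs i) x hx (hsx i) with h | h <;> rw [h] <;> norm_num
      · change 1 ≤ Bx (k i (g (s i))) x34
        rw [p2]
        rcases hcl _ (hs i) y hy (hsy i) with h | h <;> rw [h] <;> norm_num
    have hc : ((S.erase x).erase y).card = 8 := by
      rw [Finset.card_erase_of_mem (Finset.mem_erase.2 ⟨hxy.symm, hy⟩), Finset.card_erase_of_mem hx,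
        hcard]
    obtain ⟨t, -, ht2⟩ := Finset.exists_lt_card_fiber_of_mul_lt_card_of_maps_to
      (s := (Finset.univ : Finset (Fin 17))) (t := (S.erase x).erase y) (f := s) (n := 2)
      (fun i _ => Finset.mem_erase.2 ⟨hsy i, Finset.mem_erase.2 ⟨hsx i, hs i⟩⟩)
      (by rw [hc]; decide)
    obtain ⟨i, hi⟩ := Finset.card_pos.1 (lt_trans (by norm_num) ht2)
    rw [Finset.mem_filter] at hi
    have hw := tab_cnt i _ (mem_tab (hoct i))
    refine absurd (lt_of_lt_of_le ht2 (le_trans (Finset.card_le_card ?_) hw)) (lt_irrefl _)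
    intro j hj
    rw [Finset.mem_filter] at hj ⊢
    refine ⟨hj.1, ?_⟩
    rw [hi.2, ← hj.2]
    exact mem_tab (hoct j)
  obtain ⟨i, hi⟩ := main
  have ex : g.trans (k i) x = x12 := by rw [Equiv.trans_apply, hgx, hk1]
  have ey : g.trans (k i) y = x34 := by rw [Equiv.trans_apply, hgy, hk2]
  have hpb := pb_trans hg (hk i)
  refine ⟨S.image (g.trans (k i)), ?_, ?_, ⟨g.trans (k i), hpb, ?_⟩, ?_, ?_, ?_⟩
  · rw [Finset.card_image_of_injective _ (Equiv.injective _), hcard]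
  · intro u hu v hv huv
    obtain ⟨u, hu0, rfl⟩ := Finset.mem_image.1 hu
    obtain ⟨v, hv0, rfl⟩ := Finset.mem_image.1 hv
    rw [hpb]
    exact hcl u hu0 v hv0 (fun h => huv (by rw [h]))
  · congr
  · exact ⟨x12, Finset.mem_image.2 ⟨x, hx, ex⟩, rfl⟩
  · exact ⟨x34, Finset.mem_image.2 ⟨y, hy, ey⟩, rfl⟩
  · intro u hu hl
    obtain ⟨u, hu0, rfl⟩ := Finset.mem_image.1 hu
    rcases hi u hu0 hl with rfl | rfl
    · left; rw [ex]; rfl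
    · right; rw [ey]; rfl
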